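/- Let n ≥ 1 and 1 ≤ t ≤ n − 1 be integers, B = S_n, and W ⊆ ℚ^(S_n) the span of all functions f_{I,J}(π) = 1 if π(I) = J and 0 otherwise, over pairs of t-tuples I, J of distinct elements of [n]. Then W^⊥ has a (t+2)!-bounded integer basis in ℓ₁, i.e., W^⊥ is spanned by integer vectors of ℓ₁ norm at most (t+2)!. -/

import Mathlib

/-- A vector `f : B → ℚ` is integer-valued. -/
def IsIntVec {B : Type} (f : B → ℚ) : Prop := ∀ b, ∃ z : ℤ, f b = (z : ℚ)

/-- The subspace `W ⊆ ℚ^(S_n)` spanned by the indicators `f_{I,J}(π) = 1_{π(I) = J}` over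
pairs of `t`-tuples `I, J` of distinct elements of `[n]`. -/
def twiseSpace (n t : ℕ) : Submodule ℚ (Equiv.Perm (Fin n) → ℚ) :=
  Submodule.span ℚ {f : Equiv.Perm (Fin n) → ℚ |
    ∃ I J : Fin t → Fin n, Function.Injective I ∧ Function.Injective J ∧
      f = fun π => if ∀ k, π (I k) = J k then 1 else 0}

/-- The orthogonal complement `W^⊥ = {g : Σ_π f(π)·g(π) = 0 for all f ∈ W}`. -/
def perpSet {B : Type} [Fintype B] (W : Submodule ℚ (B → ℚ)) : Set (B → ℚ) :=
  {g | ∀ f ∈ W, ∑ b, f b * g b = 0}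

/-- The first point moved by a permutation is moved upwards. -/
theorem Equiv.Perm.exists_lt_apply {n : ℕ} {σ : Equiv.Perm (Fin n)} (hσ : σ ≠ 1) :
    ∃ i, i < σ i ∧ ∀ j < i, σ j = j := by
  have hne : (Finset.univ.filter fun i => σ i ≠ i).Nonempty := by
    by_contra h
    rw [Finset.not_nonempty_iff_eq_empty, Finset.filter_eq_empty_iff] at h
    exact hσ (Equiv.ext fun i => by simpa using h (Finset.mem_univ i))
  obtain ⟨i, hi, hmin⟩ := Finset.exists_min_image _ id hne
  have hfix : ∀ j < i, σ j = j := fun j hj => by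
    by_contra h
    exact absurd (hmin j (by simp [h])) (not_le.2 hj)
  refine ⟨i, lt_of_not_ge fun hle => ?_, hfix⟩
  have hi' : σ i ≠ i := by simpa using hi
  exact hi' (σ.injective (hfix _ (lt_of_le_of_ne hle hi')))

/-- The one-line notation of a permutation, as an element of the lexicographic order. -/
def oneLine {n : ℕ} (π : Equiv.Perm (Fin n)) : Lex (Fin n → Fin n) := toLex π

theorem oneLine_lt {n : ℕ} {π τ : Equiv.Perm (Fin n)} {i : Fin n}
    (h : ∀ j < i, π j = τ j) (hi : π i < τ i) : oneLine π < oneLine τ :=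
  ⟨i, h, hi⟩

/-- The signed indicator of the left coset `π H`, where `H` is the group of permutations
preserving the colouring `c`. -/
def altVec {n : ℕ} (c : Fin n → Fin n) (π τ : Equiv.Perm (Fin n)) : ℚ :=
  if ∀ i, c (π⁻¹ (τ i)) = c i then ((Equiv.Perm.sign (π⁻¹ * τ) : ℤ) : ℚ) else 0

theorem altVec_self {n : ℕ} (c : Fin n → Fin n) (π : Equiv.Perm (Fin n)) :
    altVec c π π = 1 := by
  simp [altVec]

theorem isIntVec_altVec {n : ℕ} (c : Fin n → Fin n) (π : Equiv.Perm (Fin n)) :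
    IsIntVec (altVec c π) := by
  intro τ
  unfold altVec
  split_ifs
  · exact ⟨_, rfl⟩
  · exact ⟨0, by simp⟩

theorem altVec_mul_swap {n : ℕ} {c : Fin n → Fin n} {i j : Fin n} (hij : i ≠ j)
    (hc : c i = c j) (π τ : Equiv.Perm (Fin n)) :
    altVec c π (τ * Equiv.swap i j) = -altVec c π τ := by
  have hswap : ∀ k, c (Equiv.swap i j k) = c k := fun k => by
    rw [Equiv.swap_apply_def]
    split_ifs <;> simp_all
  have hiff : (∀ k, c (π⁻¹ ((τ * Equiv.swap i j) k)) = c k) ↔ ∀ k, c (π⁻¹ (τ k)) = c k := by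
    rw [← (Equiv.swap i j).forall_congr_right (q := fun k => c (π⁻¹ (τ k)) = c k)]
    simp only [Equiv.Perm.mul_apply, hswap]
  unfold altVec
  rw [if_congr hiff rfl rfl]
  split_ifs
  · rw [← mul_assoc, Equiv.Perm.sign_mul, Equiv.Perm.sign_swap hij]
    simp
  · simp

theorem mem_perpSet_span {B : Type} [Fintype B] {s : Set (B → ℚ)} {g : B → ℚ}
    (h : ∀ f ∈ s, ∑ b, f b * g b = 0) : g ∈ perpSet (Submodule.span ℚ s) := by
  intro f hf
  induction hf using Submodule.span_induction with
  | mem f hf => exact h f hf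
  | zero => simp
  | add f f' _ _ hf hf' => simp [add_mul, Finset.sum_add_distrib, hf, hf']
  | smul a f _ hf => simp [mul_assoc, ← Finset.mul_sum, hf]

/-- The orthogonal complement as a submodule. -/
def perpSubmodule {B : Type} [Fintype B] (W : Submodule ℚ (B → ℚ)) : Submodule ℚ (B → ℚ) where
  carrier := perpSet W
  zero_mem' f _ := by simp
  add_mem' ha hb f hf := by simp [mul_add, Finset.sum_add_distrib, ha f hf, hb f hf]
  smul_mem' a g hg f hf := by simp [mul_left_comm, ← Finset.mul_sum, hg f hf]

theorem altVec_mem_perpSet {n t : ℕ} {c : Fin n → Fin n}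
    (hc : (Finset.univ.image c).card < n - t) (π : Equiv.Perm (Fin n)) :
    altVec c π ∈ perpSet (twiseSpace n t) := by
  refine mem_perpSet_span ?_
  rintro _ ⟨I, J, hI, -, rfl⟩
  obtain ⟨i, hi, j, hj, hij, hcij⟩ :=
    Finset.exists_ne_map_eq_of_card_lt_of_maps_to
      (s := (Finset.univ.image I)ᶜ) (t := Finset.univ.image c) (f := c)
      (by rwa [Finset.card_compl, Finset.card_image_of_injective _ hI, Fintype.card_fin,
        Finset.card_univ, Fintype.card_fin])
      (fun k _ => Finset.mem_coe.2 (Finset.mem_image_of_mem c (Finset.mem_univ k)))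
  simp only [Finset.mem_compl, Finset.mem_image, Finset.mem_univ, true_and, not_exists] at hi hj
  refine Finset.sum_involution (fun τ _ => τ * Equiv.swap i j) ?_ ?_ ?_ ?_
  · intro τ _
    rw [altVec_mul_swap hij hcij]
    simp [Equiv.swap_apply_of_ne_of_ne (hi _) (hj _)]
  · intro τ _ _ h
    exact hij (Equiv.swap_eq_one_iff.1 (mul_eq_left.1 h))
  · simp
  · intro τ _
    simp [mul_assoc]

theorem factorial_succ_mul_le (a b : ℕ) :
    (a + 1).factorial * (b + 1).factorial ≤ (a + b + 1).factorial := by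
  induction a with
  | zero => simp
  | succ a ih =>
    rw [show a + 1 + b + 1 = a + b + 1 + 1 by ring, Nat.factorial_succ (a + 1),
      Nat.factorial_succ (a + b + 1), mul_assoc]
    exact Nat.mul_le_mul (by omega) ih

theorem prod_factorial_succ_le {ι : Type*} (s : Finset ι) (b : ι → ℕ) :
    ∏ k ∈ s, (b k + 1).factorial ≤ (∑ k ∈ s, b k + 1).factorial := by
  classical
  induction s using Finset.induction_on with
  | empty => simp
  | insert a s ha ih =>
    rw [Finset.prod_insert ha, Finset.sum_insert ha]
    exact (Nat.mul_le_mul_left _ ih).trans (factorial_succ_mul_le _ _)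

theorem prod_factorial_fiber_le {n : ℕ} (c : Fin n → Fin n) :
    ∏ k, (Fintype.card {i // c i = k}).factorial
      ≤ (n - (Finset.univ.image c).card + 1).factorial := by
  have hpos : ∀ k ∈ Finset.univ.image c, 1 ≤ Fintype.card {i // c i = k} := by
    intro k hk
    obtain ⟨i, -, hi⟩ := Finset.mem_image.1 hk
    exact Fintype.card_pos_iff.2 ⟨⟨i, hi⟩⟩
  have hsum : ∑ k ∈ Finset.univ.image c, Fintype.card {i // c i = k} = n := by
    simp_rw [Fintype.card_subtype]
    rw [← Finset.card_eq_sum_card_image, Finset.card_univ, Fintype.card_fin]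
  have hsum' : ∑ k ∈ Finset.univ.image c, (Fintype.card {i // c i = k} - 1)
      = n - (Finset.univ.image c).card := by
    rw [Finset.sum_tsub_distrib _ hpos, hsum, Finset.sum_const, smul_eq_mul, mul_one]
  rw [← hsum', ← Finset.prod_subset (Finset.subset_univ (Finset.univ.image c))]
  · refine le_of_eq_of_le (Finset.prod_congr rfl fun k hk => ?_) (prod_factorial_succ_le _ _)
    rw [Nat.sub_add_cancel (hpos k hk)]
  · intro k _ hk
    have : IsEmpty {i // c i = k} :=
      ⟨fun i => hk (Finset.mem_image.2 ⟨i.1, Finset.mem_univ _, i.2⟩)⟩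
    rw [Fintype.card_eq_zero, Nat.factorial_zero]

theorem sum_abs_altVec_le {n : ℕ} (c : Fin n → Fin n) (π : Equiv.Perm (Fin n)) :
    ∑ τ, |altVec c π τ| ≤ ((n - (Finset.univ.image c).card + 1).factorial : ℚ) := by
  have habs : ∀ σ : Equiv.Perm (Fin n), |altVec c π (π * σ)| = if c ∘ σ = c then 1 else 0 := by
    intro σ
    have hcancel : ∀ i, π⁻¹ ((π * σ) i) = σ i := fun i => by simp
    simp only [altVec, hcancel, inv_mul_cancel_left, funext_iff, Function.comp_apply]
    split_ifs
    · rcases Int.units_eq_one_or (Equiv.Perm.sign σ) with h | h <;> simp [h]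
    · simp
  rw [← Equiv.sum_comp (Equiv.mulLeft π)]
  simp only [Equiv.coe_mulLeft, habs]
  rw [Finset.sum_boole, ← Fintype.card_subtype, DomMulAct.stabilizer_card]
  exact_mod_cast prod_factorial_fiber_le c

/-- A colouring with at most `m` colours can be refined to one with exactly `m` colours. -/
theorem exists_refinement {n m : ℕ} (hmn : m ≤ n) {γ : Type*} [DecidableEq γ] (r : Fin n → γ)
    (hr : (Finset.univ.image r).card ≤ m) :
    ∃ c : Fin n → Fin n, (Finset.univ.image c).card = m ∧ ∀ i j, c i = c j → r i = r j := by
  obtain ⟨T₀, hT₀inj, hT₀⟩ :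
      ∃ T : Finset (Fin n), Set.InjOn r T ∧ T.image r = Finset.univ.image r := by
    obtain ⟨T, -, hTinj, hT⟩ := Finset.exists_subset_injOn_image_eq_of_surjOn (f := r) Set.univ
      (Finset.univ.image r) (by intro k hk; simpa using hk)
    exact ⟨T, hTinj, hT⟩
  have hcard : T₀.card ≤ m := by rwa [← Finset.card_image_of_injOn hT₀inj, hT₀]
  obtain ⟨T, hT₀T, -, hTm⟩ := Finset.exists_subsuperset_card_eq (Finset.subset_univ T₀) hcard
    (by simpa using hmn)
  have hrep : ∀ i, ∃ j ∈ T₀, r j = r i := fun i => by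
    have : r i ∈ T₀.image r := hT₀ ▸ Finset.mem_image_of_mem r (Finset.mem_univ i)
    simpa using this
  choose p hpT hp using hrep
  refine ⟨fun i => if i ∈ T then i else p i, ?_, ?_⟩
  · rw [← hTm]
    congr 1
    ext k
    simp only [Finset.mem_image, Finset.mem_univ, true_and]
    constructor
    · rintro ⟨i, rfl⟩
      split_ifs with h
      · exact h
      · exact hT₀T (hpT i)
    · exact fun hk => ⟨k, if_pos hk⟩
  · have hc : ∀ i, r (if i ∈ T then i else p i) = r i := fun i => by
      split_ifs
      · rfl
      · exact hp i
    intro i j h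
    rw [← hc i, ← hc j]
    exact congrArg r h

/-- If all increasing subsequences of `π` have length at most `m`, the positions can be coloured
with at most `m` colours so that `π` is decreasing on every colour class. -/
theorem exists_colouring_of_increasing_le {n m : ℕ} (π : Equiv.Perm (Fin n))
    (h : ∀ s : Finset (Fin n), StrictMonoOn π s → s.card ≤ m) :
    ∃ r : Fin n → ℕ, (Finset.univ.image r).card ≤ m ∧
      ∀ i j, i < j → r i = r j → π j < π i := by
  classical
  let F : Fin n → Finset (Finset (Fin n)) := fun i =>
    Finset.univ.filter fun s => StrictMonoOn π s ∧ i ∈ s ∧ ∀ j ∈ s, j ≤ i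
  have hF : ∀ i s, s ∈ F i ↔ StrictMonoOn π s ∧ i ∈ s ∧ ∀ j ∈ s, j ≤ i := fun i s => by simp [F]
  have hsingle : ∀ i, {i} ∈ F i := fun i => by simp [hF]
  refine ⟨fun i => (F i).sup Finset.card, ?_, ?_⟩
  · have hsub : Finset.univ.image (fun i => (F i).sup Finset.card) ⊆ Finset.Icc 1 m := by
      intro k hk
      obtain ⟨i, -, rfl⟩ := Finset.mem_image.1 hk
      refine Finset.mem_Icc.2 ⟨?_, Finset.sup_le fun s hs => h s ((hF i s).1 hs).1⟩
      exact Finset.le_sup (f := Finset.card) (hsingle i)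
    simpa using Finset.card_le_card hsub
  · intro i j hij hr
    by_contra hle
    have hlt : π i < π j := lt_of_le_of_ne (not_lt.1 hle) (π.injective.ne hij.ne)
    obtain ⟨s, hs, hsup⟩ := Finset.exists_mem_eq_sup (F i) ⟨_, hsingle i⟩ Finset.card
    obtain ⟨hmono, his, hmax⟩ := (hF i s).1 hs
    have hjs : j ∉ s := fun hj => absurd (hmax j hj) (not_le.2 hij)
    have hmem : insert j s ∈ F j := by
      rw [hF]
      refine ⟨?_, Finset.mem_insert_self _ _, ?_⟩
      · intro a ha b hb hab
        rcases Finset.mem_insert.1 ha with rfl | ha' <;>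
          rcases Finset.mem_insert.1 hb with rfl | hb'
        · exact absurd hab (lt_irrefl _)
        · exact absurd (hab.trans_le (hmax b hb')) hij.not_gt
        · exact (hmono.monotoneOn ha' his (hmax a ha')).trans_lt hlt
        · exact hmono ha' hb' hab
      · intro a ha
        rcases Finset.mem_insert.1 ha with rfl | ha
        · exact le_rfl
        · exact (hmax a ha).trans hij.le
    have hcard := Finset.le_sup (f := Finset.card) hmem
    rw [Finset.card_insert_of_notMem hjs] at hcard
    simp only at hr
    omega

/-- If `π` is decreasing on the colour classes of `c`, it is the lexicographically largest element
of the support of `altVec c π`. -/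
theorem oneLine_lt_of_altVec_ne_zero {n : ℕ} {c : Fin n → Fin n} {π τ : Equiv.Perm (Fin n)}
    (hc : ∀ i j, i < j → c i = c j → π j < π i) (hτ : altVec c π τ ≠ 0) (hne : τ ≠ π) :
    oneLine τ < oneLine π := by
  have hcol : ∀ i, c (π⁻¹ (τ i)) = c i := by
    by_contra h
    exact hτ (if_neg h)
  obtain ⟨i, hi, hfix⟩ := Equiv.Perm.exists_lt_apply (σ := π⁻¹ * τ)
    (fun h => hne (inv_mul_eq_one.1 h).symm)
  refine oneLine_lt (i := i) (fun j hj => ?_) ?_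
  · exact Equiv.Perm.inv_eq_iff_eq.1 (hfix j hj)
  · simpa using hc _ _ hi (hcol i).symm

/-- If `π` is increasing on `s`, it is the lexicographically smallest permutation that agrees with
it outside `s`. -/
theorem oneLine_lt_of_strictMonoOn {n : ℕ} {s : Finset (Fin n)} {π τ : Equiv.Perm (Fin n)}
    (hs : StrictMonoOn π s) (hτ : ∀ i ∉ s, τ i = π i) (hne : τ ≠ π) :
    oneLine π < oneLine τ := by
  obtain ⟨i, hi, hfix⟩ := Equiv.Perm.exists_lt_apply (σ := π⁻¹ * τ)
    (fun h => hne (inv_mul_eq_one.1 h).symm)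
  have hmem : ∀ j, (π⁻¹ * τ) j ≠ j → j ∈ s := fun j hj => by
    by_contra h
    exact hj (by simp [hτ j h])
  refine oneLine_lt (i := i) (fun j hj => ?_) ?_
  · exact (Equiv.Perm.inv_eq_iff_eq.1 (hfix j hj)).symm
  · simpa using hs (hmem i hi.ne') (hmem _ fun h => hi.ne' ((π⁻¹ * τ).injective h)) hi

/-- Modulo the antisymmetrizers `altVec c π`, every vector is supported on the permutations with an
increasing subsequence of length `n - t`. -/
theorem exists_sub_supported {n t : ℕ} (ht : t < n) (U : Submodule ℚ (Equiv.Perm (Fin n) → ℚ))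
    (hU : ∀ c : Fin n → Fin n, (Finset.univ.image c).card = n - t - 1 → ∀ π, altVec c π ∈ U)
    (g : Equiv.Perm (Fin n) → ℚ) :
    ∃ u ∈ U, ∀ π, g π ≠ u π → ∃ s : Finset (Fin n), s.card = n - t ∧ StrictMonoOn π s := by
  classical
  let T : Submodule ℚ (Equiv.Perm (Fin n) → ℚ) :=
    { carrier := {h | ∀ π, h π ≠ 0 → ∃ s : Finset (Fin n), s.card = n - t ∧ StrictMonoOn π s}
      zero_mem' := fun π h => absurd rfl h
      add_mem' := fun {a b} ha hb π h => by
        by_cases h0 : a π = 0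
        · exact hb π fun h1 => h (by simp [h0, h1])
        · exact ha π h0
      smul_mem' := fun q a ha π h => ha π fun h0 => h (by simp [h0]) }
  have hdecomp : ∀ f : Equiv.Perm (Fin n) → ℚ, f = ∑ τ, f τ • Pi.single τ (1 : ℚ) := fun f => by
    ext ρ
    simp [Finset.sum_apply, Pi.single_apply]
  have hsingle : ∀ π : Equiv.Perm (Fin n), Pi.single π (1 : ℚ) ∈ U ⊔ T := by
    intro π
    induction hw : oneLine π using WellFoundedLT.induction generalizing π with
    | ind w ih =>
    subst hw
    by_cases hG : ∃ s : Finset (Fin n), s.card = n - t ∧ StrictMonoOn π s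
    · refine Submodule.mem_sup_right fun ρ hρ => ?_
      obtain rfl : ρ = π := by
        by_contra h
        exact hρ (by simp [h])
      exact hG
    · have hlen : ∀ s : Finset (Fin n), StrictMonoOn π s → s.card ≤ n - t - 1 := by
        intro s hs
        by_contra hlt
        obtain ⟨s', hs', hcard⟩ := Finset.exists_subset_card_eq (s := s) (n := n - t) (by omega)
        exact hG ⟨s', hcard, hs.mono (Finset.coe_subset.2 hs')⟩
      obtain ⟨r, hr, hdec⟩ := exists_colouring_of_increasing_le π hlen
      obtain ⟨c, hc, hcr⟩ := exists_refinement (by omega) r hr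
      have hsplit := hdecomp (altVec c π)
      rw [← Finset.add_sum_erase _ _ (Finset.mem_univ π), altVec_self, one_smul,
        ← sub_eq_iff_eq_add] at hsplit
      rw [← hsplit]
      refine Submodule.sub_mem _ (Submodule.mem_sup_left (hU c hc π))
        (Submodule.sum_mem _ fun τ hτ => ?_)
      by_cases h0 : altVec c π τ = 0
      · simp [h0]
      · exact Submodule.smul_mem _ _ (ih _ (oneLine_lt_of_altVec_ne_zero
          (fun i j hij h => hdec i j hij (hcr i j h)) h0 (Finset.ne_of_mem_erase hτ)) τ rfl)
  have hg : g ∈ U ⊔ T := by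
    rw [hdecomp g]
    exact Submodule.sum_mem _ fun τ _ => Submodule.smul_mem _ _ (hsingle τ)
  obtain ⟨u, hu, h, hh, rfl⟩ := Submodule.mem_sup.1 hg
  exact ⟨u, hu, fun π hπ => hh π fun h0 => hπ (by simp [h0])⟩

/-- A vector of `W^⊥` supported on the permutations with an increasing subsequence of length
`n - t` vanishes. -/
theorem eq_zero_of_mem_perpSet {n t : ℕ} (ht : t ≤ n) {h : Equiv.Perm (Fin n) → ℚ}
    (hperp : h ∈ perpSet (twiseSpace n t))
    (hsupp : ∀ π, h π ≠ 0 → ∃ s : Finset (Fin n), s.card = n - t ∧ StrictMonoOn π s) : h = 0 := by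
  classical
  by_contra hne
  have hnon : (Finset.univ.filter fun π => h π ≠ 0).Nonempty := by
    obtain ⟨π, hπ⟩ := Function.ne_iff.1 hne
    exact ⟨π, by simpa using hπ⟩
  obtain ⟨π, hπ, hmax⟩ := Finset.exists_max_image _ oneLine hnon
  have hπ0 : h π ≠ 0 := by simpa using hπ
  obtain ⟨s, hs, hmono⟩ := hsupp π hπ0
  have hcompl : sᶜ.card = t := by
    rw [Finset.card_compl, Fintype.card_fin, hs]
    omega
  let I : Fin t → Fin n := fun k => sᶜ.orderEmbOfFin hcompl k
  have hI : Function.Injective I := (sᶜ.orderEmbOfFin hcompl).injective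
  have hzero := hperp _ (Submodule.subset_span ⟨I, π ∘ I, hI, π.injective.comp hI, rfl⟩)
  rw [Finset.sum_eq_single π] at hzero
  · exact hπ0 (by simpa using hzero)
  · intro τ _ hτ
    by_cases h0 : h τ = 0
    · rw [h0, mul_zero]
    · rw [if_neg, zero_mul]
      intro hagree
      refine absurd (hmax τ (by simpa using h0))
        (not_le.2 (oneLine_lt_of_strictMonoOn hmono (fun i hi => ?_) hτ))
      have hi' : i ∈ Set.range (sᶜ.orderEmbOfFin hcompl) := by
        rw [Finset.range_orderEmbOfFin]
        simpa using hi
      obtain ⟨k, rfl⟩ := hi'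
      exact hagree k
  · simp

/-- `W^⊥` has a `(t+2)!`-bounded integer basis in `ℓ₁`: it is spanned by integer
vectors of `ℓ₁` norm at most `(t+2)!`. -/
theorem twise_perp_bounded_basis (n t : ℕ) (hn : 1 ≤ n) (ht : 1 ≤ t) (htn : t ≤ n - 1) :
    (Submodule.span ℚ {g : Equiv.Perm (Fin n) → ℚ |
        g ∈ perpSet (twiseSpace n t) ∧ IsIntVec g ∧
          ∑ π, |g π| ≤ ((t + 2).factorial : ℚ)} : Set (Equiv.Perm (Fin n) → ℚ))
      = perpSet (twiseSpace n t) := by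
  set S := {g : Equiv.Perm (Fin n) → ℚ | g ∈ perpSet (twiseSpace n t) ∧ IsIntVec g ∧
    ∑ π, |g π| ≤ ((t + 2).factorial : ℚ)}
  have hle : Submodule.span ℚ S ≤ perpSubmodule (twiseSpace n t) :=
    Submodule.span_le.2 fun g hg => hg.1
  have halt : ∀ c : Fin n → Fin n, (Finset.univ.image c).card = n - t - 1 →
      ∀ π, altVec c π ∈ Submodule.span ℚ S := fun c hc π =>
    Submodule.subset_span ⟨altVec_mem_perpSet (by omega) π, isIntVec_altVec c π,
      (sum_abs_altVec_le c π).trans_eq (by rw [hc, show n - (n - t - 1) + 1 = t + 2 by omega])⟩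
  refine Set.Subset.antisymm hle fun g hg => ?_
  obtain ⟨u, hu, hsupp⟩ := exists_sub_supported (by omega) _ halt g
  have hzero := eq_zero_of_mem_perpSet (by omega)
    ((perpSubmodule (twiseSpace n t)).sub_mem hg (hle hu)) fun π hπ => hsupp π (sub_ne_zero.1 hπ)
  rwa [sub_eq_zero.1 hzero]
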